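/- arXiv:1907.13068 — 2 statements merged into one kernel-verified Lean document; each statement's English description precedes it below -/
import Mathlib

section
/- Let q be a prime power, m ≥ 1, and d ∈ ℕ. For each ε = (ε_1,…,ε_m) ∈ {0,1}^m define D_ε = {b = (b_1,…,b_m) ∈ ℝ^m : for each i, 2b_i is an integer with 2b_i ∈ [0,q−1] if ε_i = 0 and 2b_i ∈ [q,2q−2] if ε_i = 1, and ∏_{i=1}^m (q + ε_i(q−1) − 2b_i) < d}. Let C ⊆ ℝ^m be a convex set with C ∩ D_ε = ∅ for all ε ∈ {0,1}^m, and set A = C ∩ ([0,q−1]^m ∩ ℤ^m). Then every nonzero codeword of the square code C_A^{(2)} has Hamming weight at least d. -/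
/-- The affine code `C_A`: evaluations at all points of `F^m` of polynomials whose
monomial support lies in `A`. -/
noncomputable def affineCode (F : Type) [Field F] [Fintype F] (m : ℕ)
    (A : Set (Fin m → ℕ)) : Set ((Fin m → F) → F) :=
  {v | ∃ f : MvPolynomial (Fin m) F,
        (∀ d ∈ f.support, (d : Fin m → ℕ) ∈ A) ∧ v = fun P => MvPolynomial.eval P f}

/-- The square code `C^{(2)}`: the span of all componentwise (Schur) products of
pairs of codewords of `C`. -/
noncomputable def squareCode (F : Type) [Field F] {n : Type} (C : Set (n → F)) :
    Set (n → F) :=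
  (Submodule.span F {v | ∃ c₁ ∈ C, ∃ c₂ ∈ C, v = c₁ * c₂} : Submodule F (n → F))

/-- The region `D_ε ⊆ ℝ^m`: points `b` such that each `2b_i` is an integer lying in
`[0,q−1]` when `ε_i = 0` and in `[q,2q−2]` when `ε_i = 1`, and
`∏_i (q + ε_i(q−1) − 2b_i) < d`. -/
def Deps (q d m : ℕ) (ε : Fin m → ℕ) : Set (Fin m → ℝ) :=
  {b | (∀ i, ∃ n : ℤ, (2 : ℝ) * b i = (n : ℝ) ∧
        (if ε i = 0 then 0 ≤ n ∧ n ≤ (q : ℤ) - 1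
         else (q : ℤ) ≤ n ∧ n ≤ 2 * (q : ℤ) - 2)) ∧
      ∏ i, ((q : ℝ) + (ε i : ℝ) * ((q : ℝ) - 1) - 2 * b i) < (d : ℝ)}

/-- A nonzero univariate polynomial of degree `k` is nonzero at no fewer than `q - k` points. -/
theorem Polynomial.card_sub_natDegree_le_card_eval_ne_zero {F : Type*} [Field F] [Fintype F]
    [DecidableEq F] {p : Polynomial F} (hp : p ≠ 0) :
    Fintype.card F - p.natDegree ≤ (Finset.univ.filter fun y : F => p.eval y ≠ 0).card := by
  have hroots : (Finset.univ.filter fun y : F => p.eval y = 0).card ≤ p.natDegree := by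
    refine le_trans (Finset.card_le_card fun y hy => ?_)
      ((Multiset.toFinset_card_le p.roots).trans p.card_roots')
    simpa [hp] using hy
  have hsum := Finset.card_filter_add_card_filter_not (s := (Finset.univ : Finset F))
    (fun y => p.eval y = 0)
  rw [Finset.card_univ] at hsum
  simp only [ne_eq]
  omega

/-- The footprint bound: a nonzero polynomial has a monomial `X ^ r` in its support such that
the polynomial is nonzero at no fewer than `∏ i, (q - r i)` points. -/
theorem MvPolynomial.exists_mem_support_prod_card_sub_le {F : Type*} [Field F] [Fintype F]
    [DecidableEq F] {n : ℕ} (f : MvPolynomial (Fin n) F) (hf : f ≠ 0) :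
    ∃ r ∈ f.support, ∏ i, (Fintype.card F - r i) ≤
      (Finset.univ.filter fun P : Fin n → F => eval P f ≠ 0).card := by
  induction n with
  | zero =>
    obtain ⟨r, hr⟩ := MvPolynomial.support_nonempty.mpr hf
    refine ⟨r, hr, ?_⟩
    rw [Fin.prod_univ_zero, Nat.one_le_iff_ne_zero, Finset.card_ne_zero]
    refine ⟨0, Finset.mem_filter.mpr ⟨Finset.mem_univ _, ?_⟩⟩
    rw [MvPolynomial.eq_C_of_isEmpty f] at hf ⊢
    simpa using hf
  | succ n ih =>
    set p := finSuccEquiv F n f with hp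
    have hp0 : p ≠ 0 := (map_ne_zero_iff _ (finSuccEquiv F n).injective).mpr hf
    obtain ⟨r, hr, hcard⟩ := ih p.leadingCoeff (Polynomial.leadingCoeff_ne_zero.mpr hp0)
    refine ⟨r.cons p.natDegree, mem_support_coeff_finSuccEquiv.mp hr, ?_⟩
    have hfiber : ∀ s : Fin n → F, eval s p.leadingCoeff ≠ 0 →
        Fintype.card F - p.natDegree ≤
          (Finset.univ.filter fun y : F => eval (Fin.cons y s : Fin (n + 1) → F) f ≠ 0).card := by
      intro s hs
      have hmap : p.map (eval s) ≠ 0 := fun h => hs <| by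
        simpa using congrArg (fun g => g.coeff p.natDegree) h
      simp only [eval_eq_eval_mv_eval', ← hp]
      exact (Nat.sub_le_sub_left Polynomial.natDegree_map_le _).trans
        (Polynomial.card_sub_natDegree_le_card_eval_ne_zero hmap)
    calc ∏ i, (Fintype.card F - r.cons p.natDegree i)
        = (∏ i, (Fintype.card F - r i)) * (Fintype.card F - p.natDegree) := by
          simp [Fin.prod_univ_succ, mul_comm]
      _ ≤ (Finset.univ.filter fun s : Fin n → F => eval s p.leadingCoeff ≠ 0).card *
            (Fintype.card F - p.natDegree) := Nat.mul_le_mul_right _ hcard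
      _ ≤ ∑ s ∈ Finset.univ.filter (fun s : Fin n → F => eval s p.leadingCoeff ≠ 0),
            (Finset.univ.filter fun y : F =>
              eval (Fin.cons y s : Fin (n + 1) → F) f ≠ 0).card := by
          rw [← smul_eq_mul]
          exact Finset.card_nsmul_le_sum _ _ _ fun s hs => hfiber s (Finset.mem_filter.mp hs).2
      _ = ((Finset.univ.filter fun s : Fin n → F => eval s p.leadingCoeff ≠ 0).sigma fun s =>
            Finset.univ.filter fun y : F =>
              eval (Fin.cons y s : Fin (n + 1) → F) f ≠ 0).card :=
          (Finset.card_sigma _ _).symm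
      _ ≤ _ := by
          refine Finset.card_le_card_of_injOn (fun x => Fin.cons x.2 x.1) (fun x hx => ?_) ?_
          · simpa using (Finset.mem_sigma.mp hx).2
          · rintro ⟨s, y⟩ - ⟨t, z⟩ - h
            obtain ⟨rfl, rfl⟩ := Fin.cons_inj.mp h
            rfl

/-- The exponent of the reduction of `X ^ n` modulo `X ^ q - X`, for `n ≤ 2 * q - 2`. -/
def reducedExponent (q n : ℕ) : ℕ := if n < q then n else n - (q - 1)

theorem pow_reducedExponent {F : Type*} [Field F] [Fintype F] (x : F) (n : ℕ) :
    x ^ reducedExponent (Fintype.card F) n = x ^ n := by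
  unfold reducedExponent
  split_ifs with h
  · rfl
  · have hpos : 0 < Fintype.card F := Fintype.card_pos
    obtain ⟨k, rfl⟩ := Nat.exists_eq_add_of_le (not_lt.mp h)
    rw [pow_add, FiniteField.pow_card, ← pow_succ']
    congr 1
    omega

theorem MvPolynomial.evalₗ_monomial_mul_monomial_mem {F σ : Type} [Field F] [Fintype F]
    [Fintype σ] {S : Set (σ →₀ ℕ)} {a b : σ →₀ ℕ} (x y : F)
    (h : Finsupp.equivFunOnFinite.symm
      (fun i => reducedExponent (Fintype.card F) (a i + b i)) ∈ S) :
    evalₗ F σ (monomial a x * monomial b y) ∈ (restrictSupport F S).map (evalₗ F σ) := by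
  refine ⟨monomial _ (x * y), (monomial_mem_restrictSupport F).mpr (Or.inl h), ?_⟩
  ext P
  simp [evalₗ_apply, monomial_mul, eval_monomial, Finsupp.prod_fintype, pow_reducedExponent]

/-- If the reductions of all products of monomials with exponents in `A` have their exponents in
`S`, then the square code of `C_A` consists of evaluations of polynomials supported in `S`. -/
theorem squareCode_affineCode_subset {F : Type} [Field F] [Fintype F] {m : ℕ}
    {A : Set (Fin m → ℕ)} {S : Set (Fin m →₀ ℕ)}
    (h : ∀ a ∈ A, ∀ b ∈ A, Finsupp.equivFunOnFinite.symm
      (fun i => reducedExponent (Fintype.card F) (a i + b i)) ∈ S) :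
    squareCode F (affineCode F m A) ⊆
      (MvPolynomial.restrictSupport F S).map (MvPolynomial.evalₗ F (Fin m)) := by
  refine SetLike.coe_subset_coe.mpr (Submodule.span_le.mpr ?_)
  rintro _ ⟨_, ⟨f, hf, rfl⟩, _, ⟨g, hg, rfl⟩, rfl⟩
  have hfg : ((fun P => MvPolynomial.eval P f) * fun P => MvPolynomial.eval P g) =
      MvPolynomial.evalₗ F (Fin m) (f * g) := by
    ext P
    simp [MvPolynomial.evalₗ_apply]
  rw [hfg, f.as_sum, g.as_sum, Finset.sum_mul_sum, map_sum]
  refine Submodule.sum_mem _ fun a ha => ?_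
  rw [map_sum]
  exact Submodule.sum_mem _ fun b hb =>
    MvPolynomial.evalₗ_monomial_mul_monomial_mem _ _ (h a (hf a ha) b (hg b hb))

/-- If the midpoint of two exponents avoids every `D_ε`, the reduction of the product of the
corresponding monomials has footprint at least `d`. -/
theorem le_prod_card_sub_reducedExponent {q d m : ℕ} (hq : 0 < q) {a b : Fin m → ℕ}
    (ha : ∀ i, a i ≤ q - 1) (hb : ∀ i, b i ≤ q - 1)
    (h : ∀ ε : Fin m → ℕ, (∀ i, ε i ≤ 1) →
      midpoint ℝ (fun i => (a i : ℝ)) (fun i => (b i : ℝ)) ∉ Deps q d m ε) :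
    d ≤ ∏ i, (q - reducedExponent q (a i + b i)) := by
  by_contra hlt
  have hmid : ∀ i, (2 : ℝ) * midpoint ℝ (fun i => (a i : ℝ)) (fun i => (b i : ℝ)) i =
      a i + b i := by
    intro i
    simp [midpoint_eq_smul_add]
  refine h (fun i => if a i + b i < q then 0 else 1) (fun i => by split_ifs <;> simp)
    ⟨fun i => ⟨(a i + b i : ℕ), ?_, ?_⟩, ?_⟩
  · rw [hmid]
    push_cast
    rfl
  · have := ha i
    have := hb i
    by_cases hi : a i + b i < q <;> simp only [hi, if_true, if_false, one_ne_zero] <;> omega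
  · refine lt_of_eq_of_lt ?_ (Nat.cast_lt.mpr (not_le.mp hlt))
    rw [Nat.cast_prod]
    refine Finset.prod_congr rfl fun i _ => ?_
    have := ha i
    have := hb i
    rw [hmid]
    dsimp only
    unfold reducedExponent
    split_ifs with hi
    · push_cast [hi.le]
      ring
    · rw [Nat.cast_sub (by omega), Nat.cast_sub (by omega), Nat.cast_sub (by omega)]
      push_cast
      ring

theorem stmt8 (F : Type) [Field F] [Fintype F] [DecidableEq F]
    (m d : ℕ) (hm : 1 ≤ m)
    (C : Set (Fin m → ℝ)) (hconv : Convex ℝ C)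
    (hdisj : ∀ ε : Fin m → ℕ, (∀ i, ε i ≤ 1) → C ∩ Deps (Fintype.card F) d m ε = ∅) :
    ∀ v ∈ squareCode F (affineCode F m
        {a : Fin m → ℕ | (∀ i, a i ≤ Fintype.card F - 1) ∧ (fun i => (a i : ℝ)) ∈ C}),
      v ≠ 0 → d ≤ hammingNorm v := by
  intro v hv hv0
  have hsub := squareCode_affineCode_subset
    (S := {r : Fin m →₀ ℕ | d ≤ ∏ i, (Fintype.card F - r i)}) (fun a ha b hb => by
      refine le_prod_card_sub_reducedExponent Fintype.card_pos ha.1 hb.1 fun ε hε hmem => ?_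
      exact (hdisj ε hε).subset ⟨hconv.midpoint_mem ha.2 hb.2, hmem⟩) hv
  obtain ⟨f, hf, rfl⟩ := hsub
  obtain ⟨r, hr, hcard⟩ :=
    f.exists_mem_support_prod_card_sub_le (by rintro rfl; exact hv0 (map_zero _))
  exact (hf hr : d ≤ _).trans hcard
end

section
/- Let q be a prime power, m ≥ 1, and A ⊆ [0,q−1]^m nonempty, and suppose α = (α_1,…,α_m) ∈ A attains the footprint bound, i.e., FB(C_A) = (q−α_1)⋯(q−α_m). If every β = (β_1,…,β_m) ∈ ℕ^m with β_i ≤ α_i for all i belongs to A, then the minimum distance of C_A equals FB(C_A). -/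
/-- The minimum distance of a code: the minimum Hamming weight of a nonzero codeword. -/
noncomputable def minDist (F : Type) [Field F] [Fintype F] [DecidableEq F] {m : ℕ}
    (C : Set ((Fin m → F) → F)) : ℕ :=
  sInf {w | ∃ v ∈ C, v ≠ 0 ∧ hammingNorm v = w}

open MvPolynomial in
/-- **Footprint bound.** A nonzero polynomial over a finite field has a monomial `d` in its support
such that at least `∏ i, (q - d i)` points are not zeros of the polynomial. -/
theorem exists_mem_support_prod_le_card_eval_ne_zero {F : Type*} [Field F] [Fintype F]
    [DecidableEq F] {n : ℕ} {f : MvPolynomial (Fin n) F} (hf : f ≠ 0) :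
    ∃ d ∈ f.support, ∏ i, (Fintype.card F - d i) ≤
      (Finset.univ.filter fun P : Fin n → F => eval P f ≠ 0).card := by
  induction n with
  | zero =>
    obtain ⟨d, hd⟩ := support_nonempty.mpr hf
    refine ⟨d, hd, ?_⟩
    rw [Fin.prod_univ_zero, Nat.one_le_iff_ne_zero, ← Nat.pos_iff_ne_zero, Finset.card_pos]
    refine ⟨0, ?_⟩
    rw [eq_C_of_isEmpty f] at hf ⊢
    simpa only [Finset.mem_filter_univ, eval_C, ne_eq, C_eq_zero] using hf
  | succ n ih =>
    set p := finSuccEquiv F n f with hp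
    have hp0 : p ≠ 0 := by simpa [hp] using hf
    have hc : p.leadingCoeff ≠ 0 := Polynomial.leadingCoeff_ne_zero.mpr hp0
    obtain ⟨d, hd, hle⟩ := ih hc
    refine ⟨d.cons p.natDegree, mem_support_coeff_finSuccEquiv.mp hd, ?_⟩
    rw [Fin.prod_univ_succ]
    simp only [Finsupp.cons_zero, Finsupp.cons_succ]
    have hfiber : ∀ P ∈ Finset.univ.filter fun P : Fin n → F => eval P p.leadingCoeff ≠ 0,
        Fintype.card F - p.natDegree ≤ ((Finset.univ.filter fun Q : Fin (n + 1) → F =>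
          eval Q f ≠ 0).filter fun Q => Fin.tail Q = P).card := by
      intro P hP
      have hP' : eval P p.leadingCoeff ≠ 0 := by simpa using hP
      set g := p.map (eval P) with hg
      have hdeg : g.natDegree = p.natDegree :=
        Polynomial.natDegree_map_of_leadingCoeff_ne_zero _ hP'
      have hg0 : g ≠ 0 := by
        intro h
        apply hP'
        have := congrArg (fun r => Polynomial.coeff r p.natDegree) h
        simpa [hg, Polynomial.coeff_map] using this
      have hroots : g.roots.toFinset.card ≤ p.natDegree :=
        (Multiset.toFinset_card_le _).trans (hdeg ▸ Polynomial.card_roots' g)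
      calc Fintype.card F - p.natDegree ≤ (g.roots.toFinsetᶜ).card := by
            rw [Finset.card_compl]; omega
        _ ≤ _ := by
            refine Finset.card_le_card_of_injOn (fun x => Fin.cons x P) ?_ ?_
            · intro x hx
              simp only [Finset.coe_compl, Set.mem_compl_iff, Finset.mem_coe, Multiset.mem_toFinset,
                Polynomial.mem_roots hg0, Polynomial.IsRoot.def] at hx
              simpa [eval_eq_eval_mv_eval'] using hx
            · intro x _ y _ h
              exact (Fin.cons_injective2 h).1
    calc (Fintype.card F - p.natDegree) * ∏ i, (Fintype.card F - d i)
        ≤ (Finset.univ.filter fun P : Fin n → F => eval P p.leadingCoeff ≠ 0).card *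
            (Fintype.card F - p.natDegree) := by
          rw [mul_comm]; exact Nat.mul_le_mul_right _ hle
      _ ≤ ∑ P ∈ Finset.univ.filter fun P : Fin n → F => eval P p.leadingCoeff ≠ 0,
            ((Finset.univ.filter fun Q : Fin (n + 1) → F =>
              eval Q f ≠ 0).filter fun Q => Fin.tail Q = P).card :=
          Finset.card_nsmul_le_sum _ _ _ hfiber
      _ ≤ ∑ P, ((Finset.univ.filter fun Q : Fin (n + 1) → F =>
              eval Q f ≠ 0).filter fun Q => Fin.tail Q = P).card :=
          Finset.sum_le_sum_of_subset (Finset.subset_univ _)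
      _ = _ := (Finset.card_eq_sum_card_fiberwise fun _ _ => Finset.mem_univ _).symm

open MvPolynomial in
theorem le_card_of_mem_support_prod_X_sub_C {R σ : Type*} [CommRing R] [Nontrivial R]
    [Fintype σ] (S : σ → Finset R) {d : σ →₀ ℕ}
    (hd : d ∈ (∏ i, ∏ s ∈ S i, (X i - C s : MvPolynomial σ R)).support) (j : σ) :
    d j ≤ (S j).card := by
  classical
  have hlin : ∀ i (s : R), degreeOf j (X i - C s : MvPolynomial σ R) ≤ if i = j then 1 else 0 := by
    intro i s
    refine (degreeOf_sub_le _ _ _).trans ?_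
    simp [degreeOf_X, degreeOf_C, eq_comm]
  calc d j ≤ degreeOf j (∏ i, ∏ s ∈ S i, (X i - C s : MvPolynomial σ R)) :=
        monomial_le_degreeOf j hd
    _ ≤ ∑ i, ∑ s ∈ S i, degreeOf j (X i - C s : MvPolynomial σ R) :=
        (degreeOf_prod_le _ _ _).trans (Finset.sum_le_sum fun i _ => degreeOf_prod_le _ _ _)
    _ ≤ ∑ i, ∑ s ∈ S i, if i = j then 1 else 0 :=
        Finset.sum_le_sum fun i _ => Finset.sum_le_sum fun s _ => hlin i s
    _ = (S j).card := by simp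

open MvPolynomial in
theorem card_eval_prod_X_sub_C_ne_zero {R σ : Type*} [CommRing R] [IsDomain R] [Fintype R]
    [DecidableEq R] [Fintype σ] [DecidableEq σ] (S : σ → Finset R) :
    (Finset.univ.filter fun P : σ → R =>
      eval P (∏ i, ∏ s ∈ S i, (X i - C s)) ≠ 0).card = ∏ i, (Fintype.card R - (S i).card) := by
  simp_rw [← Finset.card_compl]
  rw [← Fintype.card_piFinset]
  congr 1
  ext P
  simp [Finset.prod_eq_zero_iff, sub_eq_zero]

theorem stmt17 (F : Type) [Field F] [Fintype F] [DecidableEq F]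
    (m : ℕ) (hm : 1 ≤ m) (A : Finset (Fin m → ℕ)) (hA : A.Nonempty)
    (hbox : ∀ a ∈ A, ∀ i, a i ≤ Fintype.card F - 1)
    (α : Fin m → ℕ) (hα : α ∈ A)
    (hFB : A.inf' hA (fun a => ∏ i, (Fintype.card F - a i)) =
      ∏ i, (Fintype.card F - α i))
    (hdown : ∀ β : Fin m → ℕ, (∀ i, β i ≤ α i) → β ∈ A) :
    minDist F (affineCode F m ↑A) =
      A.inf' hA (fun a => ∏ i, (Fintype.card F - a i)) := by
  have hlt : ∀ i, α i < Fintype.card F := fun i =>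
    (hbox α hα i).trans_lt (Nat.sub_lt Fintype.card_pos one_pos)
  choose S hS using fun i =>
    Finset.exists_subset_card_eq (s := (Finset.univ : Finset F)) (hlt i).le
  set f : MvPolynomial (Fin m) F :=
    ∏ i, ∏ s ∈ S i, (MvPolynomial.X i - MvPolynomial.C s)
  have hweight : hammingNorm (fun P => MvPolynomial.eval P f) = ∏ i, (Fintype.card F - α i) := by
    refine (card_eval_prod_X_sub_C_ne_zero S).trans ?_
    simp only [hS]
  have hmem : (∏ i, (Fintype.card F - α i)) ∈
      {w | ∃ v ∈ affineCode F m ↑A, v ≠ 0 ∧ hammingNorm v = w} := by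
    refine ⟨_, ⟨f, fun d hd => hdown _ fun i => ?_, rfl⟩, ?_, hweight⟩
    · exact (le_card_of_mem_support_prod_X_sub_C S hd i).trans_eq (hS i).2
    · rw [← hammingNorm_ne_zero_iff, hweight]
      exact Finset.prod_ne_zero_iff.mpr fun i _ => (Nat.sub_pos_of_lt (hlt i)).ne'
  refine le_antisymm (hFB ▸ Nat.sInf_le hmem) (le_csInf ⟨_, hmem⟩ ?_)
  rintro _ ⟨_, ⟨g, hg, rfl⟩, hv, rfl⟩
  have hg0 : g ≠ 0 := by
    rintro rfl
    exact hv (by ext; simp)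
  obtain ⟨d, hd, hle⟩ := exists_mem_support_prod_le_card_eval_ne_zero hg0
  exact (Finset.inf'_le _ (hg d hd)).trans hle
end
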